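/- Let B ≥ 1 and i ≥ 0 be natural numbers, set t = B^i, let α ≥ 0 and c ≥ 0 be real numbers, and let M : ℕ → ℕ → ℝ. Suppose M(0, 4) ≤ c·4³ and for every j with 1 ≤ j ≤ i we have M(j, 3·B^j + 1) ≤ B · M(j-1, 3·B^{j-1} + 1) + α·B·B^j. Then M(i, 3t + 1) ≤ 64·c·t + α·B·t·i. (This instantiates the recurrence with i = log_B t and a base algorithm of message complexity M_*(n') ≤ c·(n')³, yielding the paper's claim that M_{log_B t}(3t + 1) = O(t log t), and hence that Algorithm 2 achieves Byzantine Broadcast with O(t log t) messages after adding the 2t + 1 final announcement messages.) -/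

import Mathlib

/-- Instantiating the Modular Framework recurrence with `t = B^i` and a base
algorithm of message complexity `M(0, n') ≤ c (n')³`:
`M(i, 3t + 1) ≤ 64 c t + α B t i`, i.e. `M_{log_B t}(3t+1) = O(t log t)`. -/
theorem modular_algorithm_message_complexity (B i t : ℕ) (hB : 1 ≤ B)
    (ht : t = B ^ i) (α c : ℝ) (hα : 0 ≤ α) (hc : 0 ≤ c) (M : ℕ → ℕ → ℝ)
    (hbase : M 0 4 ≤ c * 4 ^ 3)
    (hrec : ∀ j, 1 ≤ j → j ≤ i →
      M j (3 * B ^ j + 1)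
        ≤ (B : ℝ) * M (j - 1) (3 * B ^ (j - 1) + 1) + α * B * B ^ j) :
    M i (3 * t + 1) ≤ 64 * c * t + α * B * t * i := by
  subst ht
  induction i with
  | zero =>
    norm_num at hbase ⊢
    linarith
  | succ k ih =>
    have hprev := ih fun j h1 h2 => hrec j h1 (h2.trans k.le_succ)
    have hstep := hrec (k + 1) (by omega) le_rfl
    rw [Nat.add_sub_cancel] at hstep
    refine hstep.trans ?_
    calc (B : ℝ) * M k (3 * B ^ k + 1) + α * B * B ^ (k + 1)
        ≤ B * (64 * c * (B ^ k : ℕ) + α * B * (B ^ k : ℕ) * k) + α * B * B ^ (k + 1) := by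
          gcongr
      _ = 64 * c * (B ^ (k + 1) : ℕ) + α * B * (B ^ (k + 1) : ℕ) * (k + 1 : ℕ) := by
          push_cast
          ring
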